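/- Let m : Fin n → ℝ and β : Fin n → ℝ with 0 < β i < 1 for all i, and set c i = 1 − Real.sqrt (1 − (β i)²). Define the pCN_AP joint measure ν as the pushforward of μ1.prod η under (u, ξ) ↦ (u, fun i => (1 − c i)·u i + c i·m i + β i·Real.sqrt (σ i)·ξ i), and ν^⊥ = Measure.map Prod.swap ν. Then ν^⊥ and ν are equivalent, and for ν-almost every (u,v), (dν^⊥/dν)(u,v) = Real.exp (𝒥(u,v)) where 𝒥(u,v) = Φ(u) − Φ(v) − ∑ᵢ (v i − u i)·m i/σ i. In particular, the quadratic drift terms cancel because (2 − c i)·c i = (β i)² for every i, so that the Metropolis–Hastings ratio of the preconditioned Crank–Nicolson algorithm with adapted preconditioner reduces to Φ(u) − Φ(v) − ⟨v − u, m⟩_C. -/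

import Mathlib

open MeasureTheory ProbabilityTheory

open scoped ENNReal NNReal

theorem lintegral_fin_prod_eq_prod_lintegral {n : ℕ} {E : Fin n → Type*}
    [∀ i, MeasurableSpace (E i)] (μ : ∀ i, Measure (E i)) [∀ i, SigmaFinite (μ i)]
    {f : ∀ i, E i → ℝ≥0∞} (hf : ∀ i, Measurable (f i)) :
    ∫⁻ x, ∏ i, f i (x i) ∂(Measure.pi μ) = ∏ i, ∫⁻ x, f i x ∂(μ i) := by
  induction n with
  | zero => simp
  | succ n ih =>
    have hmeas : Measurable fun y : ∀ j : Fin n, E (Fin.succ j) => ∏ i, f (Fin.succ i) (y i) :=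
      Finset.measurable_prod _ fun i _ => (hf _).comp (measurable_pi_apply i)
    rw [← ((measurePreserving_piFinSuccAbove μ 0).symm).lintegral_comp_emb
      (MeasurableEquiv.measurableEmbedding _)]
    simp_rw [Fin.prod_univ_succ]
    rw [← ih (fun i => μ (Fin.succ i)) (fun i => hf (Fin.succ i))]
    exact lintegral_prod_mul (μ := μ 0) (ν := Measure.pi fun i => μ (Fin.succ i))
      (hf 0).aemeasurable hmeas.aemeasurable

theorem pi_withDensity_fin {n : ℕ} {E : Fin n → Type*}
    [∀ i, MeasurableSpace (E i)] (μ : ∀ i, Measure (E i)) [∀ i, SigmaFinite (μ i)]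
    {f : ∀ i, E i → ℝ≥0∞} (hf : ∀ i, Measurable (f i))
    [∀ i, SigmaFinite ((μ i).withDensity (f i))] :
    Measure.pi (fun i => (μ i).withDensity (f i))
      = (Measure.pi μ).withDensity (fun x => ∏ i, f i (x i)) := by
  refine Measure.pi_eq fun s hs => ?_
  rw [withDensity_apply _ (MeasurableSet.univ_pi hs),
    ← lintegral_indicator (MeasurableSet.univ_pi hs)]
  simp_rw [withDensity_apply _ (hs _), ← lintegral_indicator (hs _)]
  rw [← lintegral_fin_prod_eq_prod_lintegral μ fun i => (hf i).indicator (hs i)]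
  refine lintegral_congr fun x => ?_
  by_cases hx : x ∈ Set.univ.pi s
  · rw [Set.indicator_of_mem hx]
    exact Finset.prod_congr rfl fun i _ => (Set.indicator_of_mem (hx i trivial) _).symm
  · rw [Set.indicator_of_notMem hx]
    simp only [Set.mem_pi, not_forall] at hx
    obtain ⟨i, -, hi⟩ := hx
    exact (Finset.prod_eq_zero (Finset.mem_univ i) (Set.indicator_of_notMem hi _)).symm

theorem pi_gaussianReal_eq_withDensity {n : ℕ} (a : Fin n → ℝ) {t : Fin n → ℝ≥0}
    (ht : ∀ i, t i ≠ 0) :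
    Measure.pi (fun i => gaussianReal (a i) (t i))
      = (volume : Measure (Fin n → ℝ)).withDensity
          (fun x => ENNReal.ofReal (∏ i, gaussianPDFReal (a i) (t i) (x i))) := by
  have h : ∀ i, gaussianReal (a i) (t i) = volume.withDensity (gaussianPDF (a i) (t i)) :=
    fun i => gaussianReal_of_var_ne_zero _ (ht i)
  have : ∀ i, SigmaFinite ((volume : Measure ℝ).withDensity (gaussianPDF (a i) (t i))) :=
    fun i => h i ▸ inferInstance
  simp_rw [h]
  rw [pi_withDensity_fin _ fun i => measurable_gaussianPDF (a i) (t i), ← volume_pi]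
  congr with x
  rw [ENNReal.ofReal_prod_of_nonneg fun i _ => gaussianPDFReal_nonneg _ _ _]
  rfl

theorem map_affine_pi_gaussianReal {n : ℕ} (b s : Fin n → ℝ) :
    (Measure.pi fun _ : Fin n => gaussianReal 0 1).map (fun ξ i => b i + s i * ξ i)
      = Measure.pi fun i => gaussianReal (b i) (s i ^ 2).toNNReal := by
  have h : ∀ i, (gaussianReal 0 1).map (fun x => b i + s i * x)
      = gaussianReal (b i) (s i ^ 2).toNNReal := by
    intro i
    change (gaussianReal 0 1).map ((b i + ·) ∘ (s i * ·)) = _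
    rw [← Measure.map_map (by fun_prop) (by fun_prop), gaussianReal_map_const_mul,
      gaussianReal_map_const_add]
    congr 1
    · simp
    · rw [mul_one]
      exact (Real.toNNReal_of_nonneg (sq_nonneg _)).symm
  have : ∀ i, SigmaFinite ((gaussianReal 0 1).map (fun x => b i + s i * x)) :=
    fun i => h i ▸ inferInstance
  rw [Measure.pi_map_pi (f := fun i x => b i + s i * x) fun i => by fun_prop]
  simp_rw [h]

/-- If `x ↦ T (u, x)` pushes `η` to a measure with density `g u`, then the joint law of
`(u, T (u, x))` under `(μ.withDensity f).prod η` has density `f u * g u v`. -/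
theorem map_prod_withDensity_eq {X Y Z : Type*} [MeasurableSpace X] [MeasurableSpace Y]
    [MeasurableSpace Z] {μ : Measure X} {η : Measure Y} {ρ : Measure Z} [SFinite μ] [SFinite η]
    [SFinite ρ] {f : X → ℝ≥0∞} (hf : Measurable f) {T : X × Y → Z} (hT : Measurable T)
    {g : X × Z → ℝ≥0∞} (hg : Measurable g)
    (h : ∀ u, η.map (fun y => T (u, y)) = ρ.withDensity fun z => g (u, z)) :
    ((μ.withDensity f).prod η).map (fun p => (p.1, T p))
      = (μ.prod ρ).withDensity fun p => f p.1 * g p := by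
  ext s hs
  have hm : Measurable fun p : X × Y => (p.1, T p) := measurable_fst.prodMk hT
  have hfg : Measurable fun p : X × Z => f p.1 * g p := (hf.comp measurable_fst).mul hg
  rw [Measure.map_apply hm hs, Measure.prod_apply (hm hs), withDensity_apply _ hs,
    ← lintegral_indicator hs,
    lintegral_prod _ (hfg.indicator hs).aemeasurable,
    lintegral_withDensity_eq_lintegral_mul _ hf (measurable_measure_prodMk_left (hm hs))]
  refine lintegral_congr fun u => ?_
  have hsu : MeasurableSet (Prod.mk u ⁻¹' s) := measurable_prodMk_left hs
  have hTu : Measurable fun y => T (u, y) := hT.comp measurable_prodMk_left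
  have hgu : Measurable fun z => g (u, z) := hg.comp measurable_prodMk_left
  have h1 : η (Prod.mk u ⁻¹' ((fun p : X × Y => (p.1, T p)) ⁻¹' s))
      = η.map (fun y => T (u, y)) (Prod.mk u ⁻¹' s) := by
    rw [Measure.map_apply hTu hsu]
    rfl
  rw [Pi.mul_apply, h1, h u, withDensity_apply _ hsu, ← lintegral_indicator hsu,
    ← lintegral_const_mul _ (hgu.indicator hsu)]
  refine lintegral_congr fun z => ?_
  by_cases hz : (u, z) ∈ s
  · rw [Set.indicator_of_mem hz, Set.indicator_of_mem (show z ∈ Prod.mk u ⁻¹' s from hz)]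
  · rw [Set.indicator_of_notMem hz,
      Set.indicator_of_notMem (show z ∉ Prod.mk u ⁻¹' s from hz), mul_zero]

theorem map_swap_withDensity {X : Type*} [MeasurableSpace X] {μ : Measure X} [SFinite μ]
    (F : X × X → ℝ≥0∞) :
    ((μ.prod μ).withDensity F).map Prod.swap
      = (μ.prod μ).withDensity (F ∘ Prod.swap) := by
  ext s hs
  rw [Measure.map_apply measurable_swap hs, withDensity_apply _ (measurable_swap hs),
    withDensity_apply _ hs, ← lintegral_indicator (measurable_swap hs), ← lintegral_indicator hs,
    ← lintegral_prod_swap]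
  rfl

/-- The swap ratio of the joint density of one coordinate of the pCN_AP chain. -/
theorem gaussianPDFReal_mul_swap {s a b m : ℝ} (hs : 0 < s) (hb : 0 < b) (hab : a ^ 2 + b ^ 2 = 1)
    (x y : ℝ) :
    gaussianPDFReal 0 s.toNNReal y
        * gaussianPDFReal (a * y + (1 - a) * m) ((b * √s) ^ 2).toNNReal x
      = gaussianPDFReal 0 s.toNNReal x
        * gaussianPDFReal (a * x + (1 - a) * m) ((b * √s) ^ 2).toNNReal y
        * Real.exp (-((y - x) * m / s)) := by
  have h2 : (b * √s) ^ 2 = b ^ 2 * s := by rw [mul_pow, Real.sq_sqrt hs.le]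
  rw [h2]
  simp only [gaussianPDFReal_def, Real.coe_toNNReal _ hs.le,
    Real.coe_toNNReal _ (by positivity : 0 ≤ b ^ 2 * s)]
  have key : -(y - 0) ^ 2 / (2 * s) + -(x - (a * y + (1 - a) * m)) ^ 2 / (2 * (b ^ 2 * s))
      = -(x - 0) ^ 2 / (2 * s) + -(y - (a * x + (1 - a) * m)) ^ 2 / (2 * (b ^ 2 * s))
        + -((y - x) * m / s) := by
    field_simp
    have hb2 : b ^ 2 = 1 - a ^ 2 := by linarith
    rw [hb2]
    ring
  have key' := congrArg Real.exp key
  simp only [Real.exp_add] at key'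
  linear_combination (√(2 * Real.pi * s))⁻¹ * (√(2 * Real.pi * (b ^ 2 * s)))⁻¹ * key'

/-- Metropolis–Hastings ratio of the preconditioned Crank–Nicolson algorithm with
adapted preconditioner (pCN_AP): with target `μ1 = exp(−Φ) dμ0`, prior `μ0 = N(0, σ)`,
componentwise step sizes `β i ∈ (0,1)` with `c i = 1 − √(1 − (β i)²)`, letting `ν`
denote the joint law of `(u, v)` with `u ∼ μ1` and
`v i = (1 − c i) u i + c i m i + β i √σᵢ ξ i`, the swap `ν^⊥` is equivalent to `ν` and
`(dν^⊥/dν)(u,v) = exp(Φ(u) − Φ(v) − ∑ᵢ (vᵢ − uᵢ)mᵢ/σᵢ)`; in particular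
`(2 − cᵢ)cᵢ = βᵢ²` for every `i`. -/
theorem pCN_AP_metropolis_hastings_ratio
    (n : ℕ) (σ : Fin n → ℝ) (hσ : ∀ i, 0 < σ i)
    (Φ : (Fin n → ℝ) → ℝ) (hΦ : Measurable Φ)
    (hnorm : ∫ u, Real.exp (-Φ u)
      ∂(Measure.pi (fun i => gaussianReal 0 (σ i).toNNReal)) = 1)
    (μ1 : Measure (Fin n → ℝ))
    (hμ1 : μ1 = (Measure.pi (fun i => gaussianReal 0 (σ i).toNNReal)).withDensity
      (fun u => ENNReal.ofReal (Real.exp (-Φ u))))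
    (m : Fin n → ℝ) (β : Fin n → ℝ) (hβ : ∀ i, β i ∈ Set.Ioo (0 : ℝ) 1)
    (c : Fin n → ℝ) (hc : ∀ i, c i = 1 - Real.sqrt (1 - (β i) ^ 2))
    (ν : Measure ((Fin n → ℝ) × (Fin n → ℝ)))
    (hν : ν = Measure.map
      (fun p : (Fin n → ℝ) × (Fin n → ℝ) =>
        (p.1, fun i =>
          (1 - c i) * p.1 i + c i * m i + β i * Real.sqrt (σ i) * p.2 i))
      (μ1.prod (Measure.pi (fun _ : Fin n => gaussianReal 0 1)))) :
    ((Measure.map Prod.swap ν ≪ ν ∧ ν ≪ Measure.map Prod.swap ν) ∧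
      ∀ᵐ p ∂ν, (Measure.map Prod.swap ν).rnDeriv ν p
        = ENNReal.ofReal (Real.exp (Φ p.1 - Φ p.2
            - ∑ i, (p.2 i - p.1 i) * m i / σ i))) ∧
      ∀ i, (2 - c i) * c i = (β i) ^ 2 := by
  have hroot : ∀ i, Real.sqrt (1 - β i ^ 2) ^ 2 = 1 - β i ^ 2 := fun i =>
    Real.sq_sqrt (by nlinarith [(hβ i).1, (hβ i).2])
  have hquad : ∀ i, (2 - c i) * c i = β i ^ 2 := fun i => by
    rw [hc i]
    linear_combination -hroot i
  have hvar : ∀ i, (σ i).toNNReal ≠ 0 := fun i => (Real.toNNReal_pos.2 (hσ i)).ne'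
  have hstep : ∀ i, 0 < β i * Real.sqrt (σ i) := fun i =>
    mul_pos (hβ i).1 (Real.sqrt_pos.2 (hσ i))
  have hstepvar : ∀ i, ((β i * Real.sqrt (σ i)) ^ 2).toNNReal ≠ 0 := fun i =>
    (Real.toNNReal_pos.2 (pow_pos (hstep i) 2)).ne'
  let f : (Fin n → ℝ) → ℝ := fun u =>
    (∏ i, gaussianPDFReal 0 (σ i).toNNReal (u i)) * Real.exp (-Φ u)
  let g : (Fin n → ℝ) × (Fin n → ℝ) → ℝ := fun p =>
    ∏ i, gaussianPDFReal ((1 - c i) * p.1 i + c i * m i)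
      ((β i * Real.sqrt (σ i)) ^ 2).toNNReal (p.2 i)
  have hf : Measurable f := by
    refine (Finset.measurable_prod _ fun i _ => ?_).mul hΦ.neg.exp
    exact (measurable_gaussianPDFReal _ _).comp (measurable_pi_apply i)
  have hg : Measurable g := by
    refine Finset.measurable_prod _ fun i _ => ?_
    simp only [gaussianPDFReal]
    fun_prop
  have hf0 : ∀ u, 0 ≤ f u := fun u =>
    mul_nonneg (Finset.prod_nonneg fun i _ => gaussianPDFReal_nonneg _ _ _) (Real.exp_pos _).le
  have hg0 : ∀ p, 0 ≤ g p := fun p => Finset.prod_nonneg fun i _ => gaussianPDFReal_nonneg _ _ _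
  have hμ1' : μ1 = volume.withDensity fun u => ENNReal.ofReal (f u) := by
    rw [hμ1, pi_gaussianReal_eq_withDensity _ hvar, ← withDensity_mul]
    · congr with u
      exact (ENNReal.ofReal_mul
        (Finset.prod_nonneg fun i _ => gaussianPDFReal_nonneg _ _ _)).symm
    · refine (Finset.measurable_prod _ fun i _ => ?_).ennreal_ofReal
      exact (measurable_gaussianPDFReal _ _).comp (measurable_pi_apply i)
    · exact hΦ.neg.exp.ennreal_ofReal
  have hν' : ν = ((volume : Measure (Fin n → ℝ)).prod volume).withDensity
      fun p => ENNReal.ofReal (f p.1) * ENNReal.ofReal (g p) := by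
    rw [hν, hμ1']
    refine map_prod_withDensity_eq (T := fun (p : (Fin n → ℝ) × (Fin n → ℝ)) i =>
      (1 - c i) * p.1 i + c i * m i + β i * Real.sqrt (σ i) * p.2 i)
      (g := fun p => ENNReal.ofReal (g p)) hf.ennreal_ofReal (by fun_prop) hg.ennreal_ofReal
      fun u => ?_
    rw [map_affine_pi_gaussianReal (fun i => (1 - c i) * u i + c i * m i)
      (fun i => β i * Real.sqrt (σ i)), pi_gaussianReal_eq_withDensity _ hstepvar]
  let J : (Fin n → ℝ) × (Fin n → ℝ) → ℝ := fun p =>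
    Φ p.1 - Φ p.2 - ∑ i, (p.2 i - p.1 i) * m i / σ i
  have hJ : Measurable fun p => ENNReal.ofReal (Real.exp (J p)) := by
    refine (Measurable.exp ?_).ennreal_ofReal
    exact ((hΦ.comp measurable_fst).sub (hΦ.comp measurable_snd)).sub (by fun_prop)
  have hratio : ∀ u v, f v * g (v, u) = f u * g (u, v) * Real.exp (J (u, v)) := by
    intro u v
    have hprod := Finset.prod_congr (rfl : (Finset.univ : Finset (Fin n)) = _) fun i _ =>
      gaussianPDFReal_mul_swap (a := 1 - c i) (m := m i) (hσ i) (hβ i).1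
        (by linear_combination -hquad i) (u i) (v i)
    simp only [sub_sub_cancel, Finset.prod_mul_distrib, ← Real.exp_sum,
      Finset.sum_neg_distrib] at hprod
    have hexp : Real.exp (-Φ u) * Real.exp (J (u, v))
        = Real.exp (-Φ v) * Real.exp (-∑ i, (v i - u i) * m i / σ i) := by
      rw [← Real.exp_add, ← Real.exp_add]
      congr 1
      simp only [J]
      ring
    simp only [f, g]
    linear_combination Real.exp (-Φ v) * hprod
      - (∏ i, gaussianPDFReal 0 (σ i).toNNReal (u i))
        * (∏ i, gaussianPDFReal ((1 - c i) * u i + c i * m i)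
          ((β i * Real.sqrt (σ i)) ^ 2).toNNReal (v i)) * hexp
  have hswap : Measure.map Prod.swap ν
      = ν.withDensity fun p => ENNReal.ofReal (Real.exp (J p)) := by
    have hF : Measurable fun p : (Fin n → ℝ) × (Fin n → ℝ) =>
        ENNReal.ofReal (f p.1) * ENNReal.ofReal (g p) :=
      (hf.comp measurable_fst).ennreal_ofReal.mul hg.ennreal_ofReal
    rw [hν', map_swap_withDensity, ← withDensity_mul _ hF hJ]
    refine congrArg _ (funext fun p => ?_)
    change ENNReal.ofReal (f p.2) * ENNReal.ofReal (g (p.2, p.1))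
      = ENNReal.ofReal (f p.1) * ENNReal.ofReal (g p) * ENNReal.ofReal (Real.exp (J p))
    rw [← ENNReal.ofReal_mul (hf0 _), ← ENNReal.ofReal_mul (hf0 _),
      ← ENNReal.ofReal_mul (mul_nonneg (hf0 _) (hg0 _))]
    exact congrArg ENNReal.ofReal (hratio p.1 p.2)
  have hsfin : SigmaFinite ν := by
    rw [hν', ← funext fun p : (Fin n → ℝ) × (Fin n → ℝ) => ENNReal.ofReal_mul (hf0 p.1)]
    exact SigmaFinite.withDensity_ofReal _
  rw [hswap]
  refine ⟨⟨⟨withDensity_absolutelyContinuous _ _, ?_⟩, ?_⟩, hquad⟩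
  · exact withDensity_absolutelyContinuous' hJ.aemeasurable
      (.of_forall fun p => (ENNReal.ofReal_pos.2 (Real.exp_pos _)).ne')
  · exact Measure.rnDeriv_withDensity ν hJ
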